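/- arXiv:2407.09558 — 2 statements merged into one kernel-verified Lean document; each statement's English description precedes it below -/
import Mathlib

section
/- Let χ be a primitive even Dirichlet character of conductor f > 1 (even means χ(-1) = 1). Then |L(1, χ)| ≤ (1/2)·log f + (2 + γ - log(4π))/2, where L(1, χ) is the value at s = 1 of the Dirichlet L-function of χ and γ is the Euler–Mascheroni constant. -/
open Real

open HurwitzZeta ZMod MeasureTheory Set

theorem DirichletCharacter.IsPrimitive.norm_gaussSum_of_even {N : ℕ} [NeZero N]
    {χ : DirichletCharacter ℂ N} (hχ : χ.IsPrimitive) (heven : χ.Even) :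
    ‖gaussSum χ stdAddChar‖ = √N := by
  have hinv : ∀ k : ZMod N, χ⁻¹ (-k) = χ⁻¹ k := fun k ↦ by
    have h : χ⁻¹ (-1) = 1 := by
      rw [MulChar.inv_apply_eq_inv', heven, inv_one]
    rw [← neg_one_mul, map_mul, h, one_mul]
  have h1 := congrFun (dft_dft χ) (1 : ZMod N)
  have h2 : star (gaussSum χ stdAddChar) = gaussSum χ⁻¹ (stdAddChar (N := N))⁻¹ :=
    star_gaussSum_eq χ stdAddChar
  have h3 : star (gaussSum χ stdAddChar) * gaussSum χ stdAddChar = N := by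
    have h4 : χ (-1) = 1 := heven
    rw [h4, smul_eq_mul, mul_one, dft_apply] at h1
    rw [← h1, h2, gaussSum, Finset.sum_mul]
    refine Finset.sum_congr rfl fun k _ ↦ ?_
    rw [hχ.fourierTransform_eq_inv_mul_gaussSum, hinv, mul_one, AddChar.inv_apply, smul_eq_mul]
    ring
  have h5 : ‖gaussSum χ stdAddChar‖ ^ 2 = N := by
    have := congrArg norm h3
    rw [norm_mul, norm_star, Complex.norm_natCast] at this
    rw [sq, this]
  rw [← h5, Real.sqrt_sq (norm_nonneg _)]

theorem DirichletCharacter.IsPrimitive.norm_dft_le_of_even {N : ℕ} [NeZero N]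
    {χ : DirichletCharacter ℂ N} (hχ : χ.IsPrimitive) (heven : χ.Even) (k : ZMod N) :
    ‖𝓕 χ k‖ ≤ √N := by
  rw [hχ.fourierTransform_eq_inv_mul_gaussSum, norm_mul, hχ.norm_gaussSum_of_even heven]
  exact mul_le_of_le_one_left (Real.sqrt_nonneg _) (DirichletCharacter.norm_le_one _ _)

/-- The even kernels at the points `j / N`, with constant terms removed, add up to at most the
rescaled even kernel at `0`, with constant term removed. -/
theorem sum_evenKernel_toAddCircle_sub_le {N : ℕ} [NeZero N] {x : ℝ} (hx : 0 < x) :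
    ∑ j : ZMod N, (evenKernel (toAddCircle j) x - if j = 0 then 1 else 0) ≤
      evenKernel 0 (x / N ^ 2) - 1 := by
  have hN : (0 : ℝ) < N := Nat.cast_pos.mpr (NeZero.pos N)
  set a : ℤ → ℝ := fun n ↦ if n = 0 then 0 else rexp (-π * n ^ 2 * (x / N ^ 2))
  have ha : HasSum a (evenKernel 0 (x / N ^ 2) - 1) := by
    have := hasSum_int_evenKernel₀ 0 (t := x / N ^ 2) (by positivity)
    simpa [a] using this
  have ha0 : ∀ n, 0 ≤ a n := fun n ↦ by
    simp only [a]; split_ifs <;> positivity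
  let e : ZMod N × ℤ → ℤ := fun p ↦ p.1.val + N * p.2
  have he : Function.Injective e := by
    rintro ⟨i, m⟩ ⟨j, n⟩ h
    have hij : i = j := by simpa [e] using congrArg (Int.cast : ℤ → ZMod N) h
    subst hij
    simpa [e, NeZero.ne N] using h
  have hs : Summable (a ∘ e) := ha.summable.comp_injective he
  have hle : ∑' p, (a ∘ e) p ≤ evenKernel 0 (x / N ^ 2) - 1 := by
    rw [← ha.tsum_eq]
    exact tsum_comp_le_tsum_of_inj ha.summable ha0 he
  refine le_of_eq_of_le ?_ hle
  refine (hasSum_fintype _).unique (hs.hasSum.prod_fiberwise fun j ↦ ?_)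
  have := hasSum_int_evenKernel₀ (j.val / N) hx
  rw [← toAddCircle_apply] at this
  simp only [toAddCircle_eq_zero] at this
  convert this using 2 with n
  have h1 : ((e (j, n) : ℤ) : ℝ) = N * (n + j.val / N) := by
    simp only [e]; push_cast; field_simp; ring
  have h2 : e (j, n) = 0 ↔ (n : ℝ) + j.val / N = 0 := by
    rw [← Int.cast_eq_zero (α := ℝ), h1]; simp [hN.ne']
  simp only [Function.comp_apply, a, h2, h1]
  congr 2
  field_simp

theorem one_le_evenKernel_zero {x : ℝ} (hx : 0 < x) : 1 ≤ evenKernel 0 x := by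
  have := (hasSum_int_evenKernel₀ 0 hx).nonneg fun n ↦ by split_ifs <;> positivity
  simpa using this

theorem DirichletCharacter.norm_sum_evenKernel_le {N : ℕ} [NeZero N] (hN : 1 < N)
    (χ : DirichletCharacter ℂ N) {x : ℝ} (hx : 0 < x) :
    ‖∑ j : ZMod N, χ j * evenKernel (toAddCircle j) x‖ ≤ evenKernel 0 (x / N ^ 2) - 1 := by
  refine (norm_sum_le _ _).trans <| (Finset.sum_le_sum fun j _ ↦ ?_).trans
    (sum_evenKernel_toAddCircle_sub_le hx)
  rcases eq_or_ne j 0 with rfl | hj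
  · simpa [χ.map_zero' hN.ne'] using one_le_evenKernel_zero hx
  · have h0 : 0 ≤ evenKernel (toAddCircle j) x := by
      rw [toAddCircle_apply]
      exact (hasSum_int_evenKernel _ hx).nonneg fun n ↦ by positivity
    rw [norm_mul, Complex.norm_real, Real.norm_of_nonneg h0, if_neg hj, sub_zero]
    exact mul_le_of_le_one_left h0 (DirichletCharacter.norm_le_one _ _)

theorem DirichletCharacter.IsPrimitive.norm_sum_cosKernel_le {N : ℕ} [NeZero N] (hN : 1 < N)
    {χ : DirichletCharacter ℂ N} (hχ : χ.IsPrimitive) (heven : χ.Even) {y : ℝ} (hy : 0 < y) :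
    ‖∑ j : ZMod N, χ j * cosKernel (toAddCircle j) y‖ ≤ √N * (evenKernel 0 y - 1) := by
  have hsum : HasSum (fun n : ℤ ↦ 𝓕 χ (-(n : ZMod N)) * rexp (-π * n ^ 2 * y))
      (∑ j : ZMod N, χ j * cosKernel (toAddCircle j) y) := by
    have := hasSum_sum (s := Finset.univ) fun (j : ZMod N) _ ↦
      (hasSum_int_cosKernel (j.val / N) hy).mul_left (χ j)
    simp only [← toAddCircle_apply] at this
    refine this.congr_fun fun n ↦ ?_
    rw [dft_apply, Finset.sum_mul]
    refine Finset.sum_congr rfl fun j _ ↦ ?_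
    have h : -(j * -(n : ZMod N)) = ((j.val * n : ℤ) : ZMod N) := by simp
    rw [h, stdAddChar_coe, smul_eq_mul]
    have : 2 * (π : ℂ) * Complex.I * ((j.val * n : ℤ) : ℂ) / N =
      2 * π * Complex.I * (j.val / N : ℝ) * n := by push_cast; ring
    rw [this]; ring
  have hg : HasSum (fun n : ℤ ↦ √N * if n = 0 then 0 else rexp (-π * n ^ 2 * y))
      (√N * (evenKernel 0 y - 1)) := by
    have := (hasSum_int_evenKernel₀ 0 hy).mul_left √N
    simpa using this
  rw [← hsum.tsum_eq]
  refine tsum_of_norm_bounded hg fun n ↦ ?_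
  rcases eq_or_ne n 0 with rfl | hn
  · simp [χ⁻¹.map_zero' hN.ne', hχ.fourierTransform_eq_inv_mul_gaussSum]
  · rw [norm_mul, Complex.norm_real, Real.norm_of_nonneg (exp_pos _).le, if_neg hn]
    gcongr
    exact hχ.norm_dft_le_of_even heven _

theorem evenKernel_zero_functional_equation {x : ℝ} (hx : 0 < x) :
    evenKernel 0 x = x ^ (-(1 / 2) : ℝ) * evenKernel 0 (1 / x) := by
  rw [evenKernel_functional_equation, rpow_neg hx.le, evenKernel_eq_cosKernel_of_zero, one_div]

theorem max_one_rpow_le_evenKernel_zero {x : ℝ} (hx : 0 < x) :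
    max 1 (x ^ (-(1 / 2) : ℝ)) ≤ evenKernel 0 x := by
  refine max_le (one_le_evenKernel_zero hx) ?_
  rw [evenKernel_zero_functional_equation hx]
  exact le_mul_of_one_le_right (by positivity) (one_le_evenKernel_zero (by positivity))

theorem ofReal_cpow_one_div_two_sub_one {x : ℝ} (hx : 0 < x) :
    (x : ℂ) ^ ((1 / 2 : ℂ) - 1) = ((x ^ (-(1 / 2) : ℝ) : ℝ) : ℂ) := by
  rw [Complex.ofReal_cpow hx.le]
  norm_num

theorem mellinConvergent_hurwitzEvenFEPair_f_modif (a : UnitAddCircle) (s : ℂ) :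
    MellinConvergent (hurwitzEvenFEPair a).f_modif s :=
  ((hurwitzEvenFEPair a).isStrongFEPair_toStrongFEPair.hasMellin s).1

theorem hurwitzEvenFEPair_zero_f_modif {x : ℝ} (hx : 0 < x) (hx1 : x ≠ 1) :
    (hurwitzEvenFEPair 0).f_modif x =
      ((evenKernel 0 x - max 1 (x ^ (-(1 / 2) : ℝ)) : ℝ) : ℂ) := by
  rcases hx1.lt_or_gt with h | h
  · have : 1 ≤ x ^ (-(1 / 2) : ℝ) := one_le_rpow_of_pos_of_le_one_of_nonpos hx h.le (by norm_num)
    rw [max_eq_right this]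
    simp [WeakFEPair.f_modif, hurwitzEvenFEPair, hx, h, h.le]
  · have : x ^ (-(1 / 2) : ℝ) ≤ 1 := rpow_le_one_of_one_le_of_nonpos h.le (by norm_num)
    rw [max_eq_left this]
    simp [WeakFEPair.f_modif, hurwitzEvenFEPair, h, h.le]

/-- The constant `2 + γ - log (4π)` as twice the value at `1` of the entire part of the completed
Riemann zeta function. -/
theorem integral_evenKernel_zero_sub_max :
    IntegrableOn (fun x ↦ x ^ (-(1 / 2) : ℝ) * (evenKernel 0 x - max 1 (x ^ (-(1 / 2) : ℝ))))
      (Ioi 0) ∧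
    ∫ x in Ioi 0, x ^ (-(1 / 2) : ℝ) * (evenKernel 0 x - max 1 (x ^ (-(1 / 2) : ℝ))) =
      2 + eulerMascheroniConstant - Real.log (4 * π) := by
  have hae : ∀ᵐ x : ℝ ∂volume.restrict (Ioi 0),
      (x : ℂ) ^ ((1 / 2 : ℂ) - 1) • (hurwitzEvenFEPair 0).f_modif x =
        ((x ^ (-(1 / 2) : ℝ) * (evenKernel 0 x - max 1 (x ^ (-(1 / 2) : ℝ))) : ℝ) : ℂ) := by
    filter_upwards [ae_restrict_mem measurableSet_Ioi,
      ae_restrict_of_ae (Measure.ae_ne volume (1 : ℝ))] with x hx hx1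
    rw [hurwitzEvenFEPair_zero_f_modif hx hx1, ofReal_cpow_one_div_two_sub_one hx, smul_eq_mul,
      Complex.ofReal_mul]
  constructor
  · have h := (mellinConvergent_hurwitzEvenFEPair_f_modif 0 (1 / 2)).congr hae
    simpa [IntegrableOn] using h.re
  · have h1 : mellin (hurwitzEvenFEPair 0).f_modif (1 / 2) = 2 * completedRiemannZeta₀ 1 := by
      rw [completedRiemannZeta₀, completedHurwitzZetaEven₀, WeakFEPair.Λ₀]
      ring
    rw [completedRiemannZeta₀_one, mellin, integral_congr_ae hae, integral_complex_ofReal] at h1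
    rw [← Complex.ofReal_inj, h1]
    push_cast
    rw [Complex.ofReal_log (by positivity)]
    push_cast
    ring

theorem DirichletCharacter.Even.two_mul_LFunction_one {N : ℕ} [NeZero N] (hN : 1 < N)
    {χ : DirichletCharacter ℂ N} (hχ : χ ≠ 1) (heven : χ.Even) :
    2 * N * χ.LFunction 1 = ∫ x in Ioi (0 : ℝ), ((x ^ (-(1 / 2) : ℝ) : ℝ) : ℂ) *
      ∑ j : ZMod N, χ j * (hurwitzEvenFEPair (toAddCircle j)).f_modif x := by
  have hN0 : (N : ℂ) ≠ 0 := Nat.cast_ne_zero.mpr (NeZero.ne N)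
  have h1 : χ.LFunction 1 = (N : ℂ)⁻¹ *
      ∑ j, χ j * completedHurwitzZetaEven₀ (toAddCircle j) 1 := by
    rw [DirichletCharacter.LFunction_eq_completed_div_gammaFactor χ 1 (by simp),
      heven.gammaFactor_def, Complex.Gammaℝ_one, div_one, DirichletCharacter.completedLFunction,
      ZMod.completedLFunction_def_even heven.to_fun, Complex.cpow_neg_one]
    simp only [completedHurwitzZetaEven_eq, toAddCircle_eq_zero, mul_sub,
      Finset.sum_sub_distrib, ← Finset.sum_mul, χ.sum_eq_zero_of_ne_one hχ]
    simp [χ.map_zero' hN.ne']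
  rw [h1, mul_assoc, mul_inv_cancel_left₀ hN0, Finset.mul_sum]
  simp_rw [Finset.mul_sum]
  have h2 : ∀ j : ZMod N, IntegrableOn (fun x : ℝ ↦ ((x ^ (-(1 / 2) : ℝ) : ℝ) : ℂ) *
      (χ j * (hurwitzEvenFEPair (toAddCircle j)).f_modif x)) (Ioi 0) := fun j ↦ by
    have h := (mellinConvergent_hurwitzEvenFEPair_f_modif (toAddCircle j) (1 / 2)).const_mul (χ j)
    refine IntegrableOn.congr_fun h (fun x hx ↦ ?_) measurableSet_Ioi
    simp only [ofReal_cpow_one_div_two_sub_one hx, smul_eq_mul]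
    ring
  rw [integral_finsetSum _ fun j _ ↦ h2 j]
  refine Finset.sum_congr rfl fun j _ ↦ ?_
  rw [completedHurwitzZetaEven₀, WeakFEPair.Λ₀, mellin, mul_left_comm, mul_div_cancel₀ _ two_ne_zero,
    ← integral_const_mul]
  refine setIntegral_congr_fun measurableSet_Ioi fun x hx ↦ ?_
  simp only [ofReal_cpow_one_div_two_sub_one hx, smul_eq_mul]
  ring

theorem DirichletCharacter.norm_sum_f_modif_le {N : ℕ} [NeZero N] (hN : 1 < N)
    {χ : DirichletCharacter ℂ N} (hχ : χ ≠ 1) (x : ℝ) :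
    ‖∑ j : ZMod N, χ j * (hurwitzEvenFEPair (toAddCircle j)).f_modif x‖ ≤
      ‖∑ j : ZMod N, χ j * evenKernel (toAddCircle j) x‖ := by
  simp only [WeakFEPair.f_modif, hurwitzEvenFEPair, Pi.add_apply, indicator_apply,
    toAddCircle_eq_zero, Function.comp_apply, mem_Ioi, mem_Ioo]
  by_cases h1 : 1 < x
  · simp [h1, h1.not_gt, mul_sub, χ.map_zero' hN.ne']
  · by_cases h2 : 0 < x ∧ x < 1
    · simp [h1, h2, mul_sub, ← Finset.sum_mul, χ.sum_eq_zero_of_ne_one hχ]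
    · simp [h1, h2]

theorem integral_indicator_Ioc_inv_add_rpow {a b : ℝ} (ha : 0 < a) (hab : a ≤ b) (p q : ℝ) :
    IntegrableOn ((Ioc a b).indicator fun x ↦ p * x⁻¹ + q * x ^ (-(1 / 2) : ℝ)) (Ioi 0) ∧
    ∫ x in Ioi 0, (Ioc a b).indicator (fun x ↦ p * x⁻¹ + q * x ^ (-(1 / 2) : ℝ)) x =
      p * Real.log (b / a) + q * (2 * √b - 2 * √a) := by
  have h0 : (0 : ℝ) ∉ uIcc a b := by
    rw [uIcc_of_le hab]
    exact fun h ↦ ha.not_ge h.1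
  have hsub : Ioc a b ⊆ Ioi 0 := fun x hx ↦ ha.trans hx.1
  have h1 : IntervalIntegrable (fun x : ℝ ↦ x⁻¹) volume a b :=
    intervalIntegral.intervalIntegrable_inv (fun x hx h ↦ h0 (h ▸ hx)) continuousOn_id
  have h2 : IntervalIntegrable (fun x : ℝ ↦ x ^ (-(1 / 2) : ℝ)) volume a b :=
    intervalIntegral.intervalIntegrable_rpow (.inr h0)
  constructor
  · refine IntegrableOn.integrable_indicator ?_ measurableSet_Ioc |>.integrableOn
    exact (intervalIntegrable_iff_integrableOn_Ioc_of_le hab).mp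
      ((h1.const_mul p).add (h2.const_mul q))
  · rw [setIntegral_indicator measurableSet_Ioc, inter_eq_right.mpr hsub,
      ← intervalIntegral.integral_of_le hab, intervalIntegral.integral_add (h1.const_mul p)
      (h2.const_mul q), intervalIntegral.integral_const_mul, intervalIntegral.integral_const_mul,
      integral_inv_of_pos ha (ha.trans_le hab), integral_rpow (.inr ⟨by norm_num, h0⟩),
      sqrt_eq_rpow, sqrt_eq_rpow]
    norm_num
    ring_nf
    simp

theorem rpow_neg_one_div_two_mul_self {x : ℝ} (hx : 0 < x) :
    x ^ (-(1 / 2) : ℝ) * x ^ (-(1 / 2) : ℝ) = x⁻¹ := by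
  rw [← rpow_add hx, ← rpow_neg_one]
  norm_num

theorem div_sq_rpow_neg_one_div_two {x c : ℝ} (hx : 0 < x) (hc : 0 < c) :
    (x / c ^ 2) ^ (-(1 / 2) : ℝ) = c * x ^ (-(1 / 2) : ℝ) := by
  rw [div_rpow hx.le (by positivity), ← rpow_natCast, ← rpow_mul hc.le]
  norm_num [rpow_neg_one]
  ring

theorem DirichletCharacter.IsPrimitive.rpow_mul_norm_sum_evenKernel_le {N : ℕ} [NeZero N]
    (hN : 1 < N) {χ : DirichletCharacter ℂ N} (hχ : χ.IsPrimitive) (heven : χ.Even) {x : ℝ}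
    (hx : 0 < x) :
    x ^ (-(1 / 2) : ℝ) * ‖∑ j : ZMod N, χ j * evenKernel (toAddCircle j) x‖ ≤
      x ^ (-(1 / 2) : ℝ) *
          (evenKernel 0 (x / N ^ 2) - max 1 ((x / N ^ 2) ^ (-(1 / 2) : ℝ))) +
        √N * (x ^ (-(1 / 2) : ℝ) * (evenKernel 0 x - max 1 (x ^ (-(1 / 2) : ℝ)))) +
        (Ioc (N : ℝ) (N ^ 2)).indicator (fun x ↦ N * x⁻¹ + (-1) * x ^ (-(1 / 2) : ℝ)) x +
        (Ioc (1 : ℝ) N).indicator (fun x ↦ (-√N) * x⁻¹ + √N * x ^ (-(1 / 2) : ℝ)) x := by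
  have hN0 : (0 : ℝ) < N := Nat.cast_pos.mpr (NeZero.pos N)
  have hH1 := sub_nonneg.mpr (max_one_rpow_le_evenKernel_zero hx)
  have hH2 := sub_nonneg.mpr (max_one_rpow_le_evenKernel_zero (x := x / N ^ 2) (by positivity))
  have hA := χ.norm_sum_evenKernel_le hN hx
  have hB : ‖∑ j : ZMod N, χ j * evenKernel (toAddCircle j) x‖ ≤
      √N * (evenKernel 0 x - x ^ (-(1 / 2) : ℝ)) := by
    have h := hχ.norm_sum_cosKernel_le hN heven (y := 1 / x) (by positivity)
    have h1 : ∑ j : ZMod N, χ j * evenKernel (toAddCircle j) x =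
        ((x ^ (-(1 / 2) : ℝ) : ℝ) : ℂ) * ∑ j : ZMod N, χ j * cosKernel (toAddCircle j) (1 / x) := by
      rw [Finset.mul_sum]
      refine Finset.sum_congr rfl fun j _ ↦ ?_
      rw [evenKernel_functional_equation, rpow_neg hx.le, one_div (x ^ _), Complex.ofReal_mul]
      ring
    rw [h1, norm_mul, Complex.norm_real, norm_of_nonneg (by positivity),
      evenKernel_zero_functional_equation hx]
    refine (mul_le_mul_of_nonneg_left h (by positivity)).trans_eq ?_
    ring
  have hr := rpow_neg_one_div_two_mul_self hx
  rw [div_sq_rpow_neg_one_div_two hx hN0] at hH2 ⊢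
  have hrle : 1 ≤ x → x ^ (-(1 / 2) : ℝ) ≤ 1 := fun h ↦
    rpow_le_one_of_one_le_of_nonpos h (by norm_num)
  have hrge : x ≤ 1 → 1 ≤ x ^ (-(1 / 2) : ℝ) := fun h ↦
    one_le_rpow_of_pos_of_le_one_of_nonpos hx h (by norm_num)
  have hNr : x ≤ N ^ 2 → 1 ≤ N * x ^ (-(1 / 2) : ℝ) := fun h ↦ by
    rw [← div_sq_rpow_neg_one_div_two hx hN0]
    exact one_le_rpow_of_pos_of_le_one_of_nonpos (by positivity)
      ((div_le_one (by positivity)).mpr h) (by norm_num)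
  have hNr' : N ^ 2 ≤ x → N * x ^ (-(1 / 2) : ℝ) ≤ 1 := fun h ↦ by
    rw [← div_sq_rpow_neg_one_div_two hx hN0]
    exact rpow_le_one_of_one_le_of_nonpos ((one_le_div (by positivity)).mpr h) (by norm_num)
  have hr0 : 0 < x ^ (-(1 / 2) : ℝ) := by positivity
  simp only [indicator_apply, mem_Ioc]
  generalize x ^ (-(1 / 2) : ℝ) = r at *
  rcases lt_or_ge (N : ℝ) x with h | h
  · have hA' := mul_le_mul_of_nonneg_left hA hr0.le
    have h3 : 0 ≤ √N * (r * (evenKernel 0 x - max 1 r)) := by positivity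
    rcases le_or_gt x (N ^ 2) with h' | h'
    · rw [if_pos ⟨h, h'⟩, if_neg (fun h0 ↦ h.not_ge h0.2), max_eq_right (hNr h'), ← hr]
      linarith
    · rw [if_neg (fun h0 ↦ h'.not_ge h0.2), if_neg (fun h0 ↦ h.not_ge h0.2),
        max_eq_left (hNr' h'.le)]
      linarith
  · have hB' := mul_le_mul_of_nonneg_left hB hr0.le
    have h3 := mul_nonneg hr0.le hH2
    rw [if_neg (fun h0 ↦ h.not_gt h0.1)]
    rcases lt_or_ge 1 x with h' | h'
    · rw [if_pos ⟨h', h⟩, max_eq_left (hrle h'.le), ← hr]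
      linarith
    · rw [if_neg (fun h0 ↦ h'.not_gt h0.1), max_eq_right (hrge h')]
      linarith

theorem integral_evenKernel_zero_sub_max_div_sq {c : ℝ} (hc : 0 < c) :
    IntegrableOn (fun x ↦ x ^ (-(1 / 2) : ℝ) *
      (evenKernel 0 (x / c ^ 2) - max 1 ((x / c ^ 2) ^ (-(1 / 2) : ℝ)))) (Ioi 0) ∧
    ∫ x in Ioi 0, x ^ (-(1 / 2) : ℝ) *
      (evenKernel 0 (x / c ^ 2) - max 1 ((x / c ^ 2) ^ (-(1 / 2) : ℝ))) =
      c * (2 + eulerMascheroniConstant - Real.log (4 * π)) := by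
  obtain ⟨hi, hI⟩ := integral_evenKernel_zero_sub_max
  set g : ℝ → ℝ := fun x ↦
    x ^ (-(1 / 2) : ℝ) * (evenKernel 0 x - max 1 (x ^ (-(1 / 2) : ℝ))) with hg
  have hc2 : 0 < (c ^ 2)⁻¹ := by positivity
  have hEq : EqOn (fun x ↦ c⁻¹ * g ((c ^ 2)⁻¹ * x)) (fun x ↦ x ^ (-(1 / 2) : ℝ) *
      (evenKernel 0 (x / c ^ 2) - max 1 ((x / c ^ 2) ^ (-(1 / 2) : ℝ)))) (Ioi 0) := fun x hx ↦ by
    simp only [hg, inv_mul_eq_div (c ^ 2), div_sq_rpow_neg_one_div_two hx hc]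
    field_simp
  constructor
  · refine IntegrableOn.congr_fun (Integrable.const_mul ?_ c⁻¹) hEq measurableSet_Ioi
    exact (integrableOn_Ioi_comp_mul_left_iff g 0 hc2).mpr (by simpa using hi)
  · rw [← setIntegral_congr_fun measurableSet_Ioi hEq, integral_const_mul,
      integral_comp_mul_left_Ioi g 0 hc2, mul_zero, hI, smul_eq_mul, inv_inv]
    field_simp

theorem two_add_eulerMascheroniConstant_sub_log_le {x : ℝ} (hx : 2 ≤ x) :
    2 + eulerMascheroniConstant - Real.log (4 * π) ≤ Real.log x := by
  have h1 := eulerMascheroniConstant_lt_two_thirds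
  have h2 : (3 : ℝ) ≤ Real.log (x * (4 * π)) := by
    rw [le_log_iff_exp_le (by positivity)]
    have h3 : rexp 3 = rexp 1 ^ 3 := by rw [← exp_nat_mul]; norm_num
    have h4 : rexp 1 ^ 3 ≤ 2.72 ^ 3 := by
      gcongr
      linarith [exp_one_lt_d9]
    nlinarith [pi_gt_three]
  rw [log_mul (by positivity) (by positivity)] at h2
  linarith

/-- Louboutin's bound for even primitive Dirichlet characters: if `χ` is a primitive
even Dirichlet character of conductor `f > 1`, then
`|L(1,χ)| ≤ (1/2)·log f + (2 + γ - log(4π))/2`. -/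
theorem stmt_6 (f : ℕ) [NeZero f] (hf : 1 < f) (χ : DirichletCharacter ℂ f)
    (hχ : χ.IsPrimitive) (heven : χ.Even) :
    ‖χ.LFunction 1‖ ≤
      (1 / 2) * Real.log f + (2 + eulerMascheroniConstant - Real.log (4 * π)) / 2 := by
  have hf1 : (1 : ℝ) < f := Nat.one_lt_cast.mpr hf
  have hf0 : (0 : ℝ) < f := one_pos.trans hf1
  have hχ1 : χ ≠ 1 := by
    rintro rfl
    rw [DirichletCharacter.isPrimitive_def, DirichletCharacter.conductor_one] at hχ
    exact hf.ne hχ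
  obtain ⟨hi₁, hI₁⟩ := integral_evenKernel_zero_sub_max_div_sq hf0
  obtain ⟨hi₂, hI₂⟩ := integral_evenKernel_zero_sub_max
  obtain ⟨hi₃, hI₃⟩ := integral_indicator_Ioc_inv_add_rpow hf0
    (le_self_pow₀ hf1.le two_ne_zero) f (-1)
  obtain ⟨hi₄, hI₄⟩ := integral_indicator_Ioc_inv_add_rpow one_pos hf1.le (-√f) √f
  have hi₂' := Integrable.const_mul hi₂ √f
  have key : 2 * f * ‖χ.LFunction 1‖ ≤
      f * (2 + eulerMascheroniConstant - Real.log (4 * π)) +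
        √f * (2 + eulerMascheroniConstant - Real.log (4 * π)) +
        (f * Real.log (f ^ 2 / f) + (-1) * (2 * √(f ^ 2) - 2 * √f)) +
        (-√f * Real.log (f / 1) + √f * (2 * √f - 2 * √1)) := by
    rw [← hI₁, ← hI₃, ← hI₄, ← hI₂, ← integral_const_mul, ← integral_add' hi₁ hi₂',
      ← integral_add' (hi₁.add hi₂') hi₃, ← integral_add' ((hi₁.add hi₂').add hi₃) hi₄]
    have h2 : ‖(2 * f : ℂ) * χ.LFunction 1‖ = 2 * f * ‖χ.LFunction 1‖ := by simp
    rw [← h2, heven.two_mul_LFunction_one hf hχ1]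
    refine norm_integral_le_of_norm_le (((hi₁.add hi₂').add hi₃).add hi₄) ?_
    filter_upwards [ae_restrict_mem measurableSet_Ioi] with x hx
    have hr : 0 ≤ x ^ (-(1 / 2) : ℝ) := rpow_nonneg (le_of_lt hx) _
    rw [norm_mul, Complex.norm_real, norm_of_nonneg hr]
    exact (mul_le_mul_of_nonneg_left (χ.norm_sum_f_modif_le hf hχ1 x) hr).trans
      (hχ.rpow_mul_norm_sum_evenKernel_le hf heven hx)
  have hc := two_add_eulerMascheroniConstant_sub_log_le (x := f) (by exact_mod_cast hf)
  have hc' := mul_le_mul_of_nonneg_left hc (sqrt_nonneg (f : ℝ))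
  rw [sqrt_sq hf0.le, div_one, sq, mul_div_cancel_right₀ _ hf0.ne', sqrt_one] at key
  have hs := mul_self_sqrt hf0.le
  refine le_of_mul_le_mul_left ?_ (mul_pos two_pos hf0)
  linarith
end

section
/- Let χ be a primitive odd Dirichlet character of conductor f > 1 (odd means χ(-1) = -1). Then |L(1, χ)| ≤ (1/2)·log f + (2 + γ - log π)/2, where L(1, χ) is the value at s = 1 of the Dirichlet L-function of χ and γ is the Euler–Mascheroni constant. -/
open Real
open MeasureTheory Set Filter Topology

lemma Real.log_le_half_sub_inv {x : ℝ} (hx : 1 ≤ x) : log x ≤ (x - x⁻¹) / 2 := by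
  rw [← sinh_log (by positivity)]
  exact self_le_sinh_iff.2 (log_nonneg hx)

lemma harmonic_le_log_add_eulerMascheroniConstant {n : ℕ} (hn : 1 ≤ n) :
    (harmonic n : ℝ) ≤ log n + eulerMascheroniConstant + 1 / (2 * n) := by
  have hmono : Monotone fun k : ℕ ↦
      (harmonic (k + 1) : ℝ) - log (k + 1 : ℕ) - 1 / 2 * ((k + 1 : ℕ) : ℝ)⁻¹ := by
    refine monotone_nat_of_le_succ fun k ↦ ?_
    have h := log_le_half_sub_inv (x := (k + 2 : ℝ) / (k + 1)) (by
      rw [one_le_div (by positivity)]; linarith)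
    rw [log_div (by positivity) (by positivity)] at h
    have h2 : ((k + 2 : ℝ) / (k + 1) - ((k + 2 : ℝ) / (k + 1))⁻¹) / 2 =
        1 / 2 * ((k : ℝ) + 1)⁻¹ + 1 / 2 * ((k : ℝ) + 2)⁻¹ := by
      field_simp; ring
    rw [h2] at h
    have h3 : (harmonic (k + 1 + 1) : ℝ) = harmonic (k + 1) + ((k : ℝ) + 2)⁻¹ := by
      rw [harmonic_succ]; push_cast; ring
    have h4 : ((k + 1 + 1 : ℕ) : ℝ) = k + 2 := by push_cast; ring
    rw [h3, h4]
    push_cast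
    linarith
  have hlim : Tendsto (fun k : ℕ ↦
      (harmonic (k + 1) : ℝ) - log (k + 1 : ℕ) - 1 / 2 * ((k + 1 : ℕ) : ℝ)⁻¹) atTop
      (𝓝 (eulerMascheroniConstant - 1 / 2 * 0)) :=
    ((tendsto_add_atTop_iff_nat 1).2 tendsto_harmonic_sub_log).sub
      (((tendsto_add_atTop_iff_nat 1).2 (tendsto_inv_atTop_nhds_zero_nat (𝕜 := ℝ))).const_mul _)
  obtain ⟨k, rfl⟩ := Nat.exists_eq_add_of_le' hn
  have h := hmono.ge_of_tendsto hlim k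
  have h2 : (1 : ℝ) / (2 * (k + 1 : ℕ)) = 1 / 2 * ((k + 1 : ℕ) : ℝ)⁻¹ := by
    rw [one_div, mul_inv]; ring
  rw [h2]
  linarith

lemma integral_log_mul_exp_neg :
    ∫ t in Ioi (0 : ℝ), log t * exp (-t) = -eulerMascheroniConstant := by
  have h1 := Complex.hasDerivAt_GammaIntegral (s := 1) (by simp)
  have h2 : HasDerivAt Complex.GammaIntegral (-eulerMascheroniConstant : ℂ) 1 := by
    refine Complex.hasDerivAt_Gamma_one.congr_of_eventuallyEq ?_
    have : IsOpen {s : ℂ | 0 < s.re} := Complex.continuous_re.isOpen_preimage _ isOpen_Ioi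
    filter_upwards [this.mem_nhds (x := 1) (by simp)] with s hs
    exact (Complex.Gamma_eq_integral hs).symm
  have h3 := h1.unique h2
  simp only [sub_self, Complex.cpow_zero, one_mul] at h3
  rw [← Complex.ofReal_inj, ← integral_complex_ofReal]
  push_cast
  exact_mod_cast h3

lemma integrableOn_log_mul_exp_neg :
    IntegrableOn (fun t : ℝ ↦ log t * exp (-t)) (Ioi 0) :=
  .of_integral_ne_zero <| by
    rw [integral_log_mul_exp_neg]
    linarith [one_half_lt_eulerMascheroniConstant]

lemma integrableOn_inv_sqrt_mul_exp_neg :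
    IntegrableOn (fun t : ℝ ↦ (√t)⁻¹ * exp (-t)) (Ioi 0) := by
  refine (GammaIntegral_convergent (s := 1 / 2) (by norm_num)).congr_fun (fun t ht ↦ ?_)
    measurableSet_Ioi
  have : (1 / 2 - 1 : ℝ) = -(1 / 2) := by norm_num
  simp only [this]
  rw [rpow_neg (le_of_lt ht), ← sqrt_eq_rpow, mul_comm]

/-- The `n`-th summand of the majorant, as a density against `exp (-v)` on `v > n ^ 2 * a`. -/
noncomputable def thetaMajorant (a : ℝ) (n : ℕ) (v : ℝ) : ℝ :=
  ((n : ℝ)⁻¹ + √a * (√v)⁻¹) * exp (-v)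

/-- The remainder density after removing the first `n` summands of the majorant. -/
noncomputable def thetaRemainder (a : ℝ) (n : ℕ) (v : ℝ) : ℝ :=
  (1 / 2 * log (v / a) + eulerMascheroniConstant + 1 - harmonic n - n * (√a * (√v)⁻¹)) * exp (-v)

section ThetaMajorant

variable {a : ℝ}

lemma integrableOn_thetaMajorant (n : ℕ) : IntegrableOn (thetaMajorant a n) (Ioi 0) := by
  have h := ((integrableOn_exp_neg_Ioi 0).const_mul ((n : ℝ)⁻¹)).add
    (integrableOn_inv_sqrt_mul_exp_neg.const_mul (√a))
  refine IntegrableOn.congr_fun h (fun v _ ↦ ?_) measurableSet_Ioi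
  simp only [Pi.add_apply, thetaMajorant]
  ring

lemma integrableOn_thetaRemainder (ha : 0 < a) (n : ℕ) :
    IntegrableOn (thetaRemainder a n) (Ioi 0) := by
  have h := ((integrableOn_log_mul_exp_neg.const_mul (1 / 2)).add
    ((integrableOn_exp_neg_Ioi 0).const_mul
      (-1 / 2 * log a + eulerMascheroniConstant + 1 - harmonic n))).add
    (integrableOn_inv_sqrt_mul_exp_neg.const_mul (-(n * √a)))
  refine IntegrableOn.congr_fun h (fun v hv ↦ ?_) measurableSet_Ioi
  simp only [Pi.add_apply, thetaRemainder]
  rw [log_div (ne_of_gt hv) ha.ne']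
  ring

lemma integral_thetaRemainder_zero (ha : 0 < a) :
    ∫ v in Ioi 0, thetaRemainder a 0 v = 1 + eulerMascheroniConstant / 2 - log a / 2 := by
  have h : ∀ v ∈ Ioi (0 : ℝ), thetaRemainder a 0 v = 1 / 2 * (log v * exp (-v)) +
      (-1 / 2 * log a + eulerMascheroniConstant + 1) * exp (-v) := fun v hv ↦ by
    rw [thetaRemainder, log_div (ne_of_gt hv) ha.ne']
    simp only [harmonic_zero, Rat.cast_zero, Nat.cast_zero]
    ring
  rw [setIntegral_congr_fun measurableSet_Ioi h,
    integral_add (integrableOn_log_mul_exp_neg.const_mul _)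
      ((integrableOn_exp_neg_Ioi 0).const_mul _), integral_const_mul, integral_const_mul,
    integral_log_mul_exp_neg, integral_exp_neg_Ioi]
  simp only [neg_zero, exp_zero]
  ring

lemma thetaRemainder_sub_thetaMajorant (n : ℕ) (v : ℝ) :
    thetaRemainder a (n + 1) v + thetaMajorant a (n + 1) v = thetaRemainder a n v := by
  simp only [thetaRemainder, thetaMajorant, harmonic_succ]
  push_cast
  ring

lemma quadratic_majorant_nonneg {n : ℕ} (hn : 1 ≤ n) (r s : ℝ) :
    0 ≤ (2 - 1 / (2 * n)) * (s ^ 2 - n ^ 2 * r ^ 2) - 4 * n * r * (s - n * r) + r ^ 2 / 6 := by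
  have hn' : (1 : ℝ) ≤ n := by exact_mod_cast hn
  have h1 : (3 / 2 : ℝ) ≤ 2 - 1 / (2 * n) := by
    have : (1 : ℝ) / (2 * n) ≤ 1 / 2 := by
      rw [div_le_div_iff₀ (by positivity) (by positivity)]; linarith
    linarith
  have h2 : (1 : ℝ) / (2 * n) * n = 1 / 2 := by field_simp
  have : (2 - 1 / (2 * n)) * (s ^ 2 - n ^ 2 * r ^ 2) - 4 * n * r * (s - n * r) + r ^ 2 / 6
      = (2 - 1 / (2 * n)) * (s - n * r) ^ 2 - r * (s - n * r) * (2 * (1 / (2 * n) * n))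
        + r ^ 2 / 6 := by ring
  rw [this, h2]
  nlinarith [mul_le_mul_of_nonneg_right h1 (sq_nonneg (s - n * r)), sq_nonneg (s - n * r - r / 3)]

/-- The area lost over `(n ^ 2 * a, b)` is at most `a / 6 * exp (-n ^ 2 * a)`, and it is partly
regained when `b` is the next breakpoint. -/
lemma le_integral_thetaRemainder (ha : 0 < a) {n : ℕ} (hn : 1 ≤ n) {b : ℝ} (hb : n ^ 2 * a ≤ b) :
    ((2 - 1 / (2 * n)) * (b - n ^ 2 * a) - 4 * n * √a * (√b - n * √a) + a / 6) * exp (-b)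
      - a / 6 * exp (-(n ^ 2 * a)) ≤ ∫ v in n ^ 2 * a..b, thetaRemainder a n v := by
  have hn' : (1 : ℝ) ≤ n := by exact_mod_cast hn
  have hpos : 0 < n ^ 2 * a := by positivity
  have key := intervalIntegral.sub_le_integral_of_hasDeriv_right_of_le
    (g := fun v ↦ ((2 - 1 / (2 * n)) * (v - n ^ 2 * a) - 4 * n * √a * (√v - n * √a) + a / 6)
      * exp (-v))
    (g' := fun v ↦ ((2 - 1 / (2 * n)) * 1 - 4 * n * √a * (1 / (2 * √v))) * exp (-v) +
      ((2 - 1 / (2 * n)) * (v - n ^ 2 * a) - 4 * n * √a * (√v - n * √a) + a / 6)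
      * (exp (-v) * (-1)))
    (φ := thetaRemainder a n) hb (by fun_prop) ?_ ?_ ?_
  · refine le_trans (le_of_eq ?_) key
    have : √(n ^ 2 * a) = n * √a := by
      rw [sqrt_mul (by positivity), sqrt_sq (by positivity)]
    simp only [this]
    ring
  · intro v hv
    have hv0 : v ≠ 0 := (hpos.trans hv.1).ne'
    refine HasDerivAt.hasDerivWithinAt (.mul (.add_const _ (.sub (.const_mul _ ?_)
      (.const_mul _ ?_))) (hasDerivAt_neg v).exp)
    · exact (hasDerivAt_id v).sub_const _
    · exact (hasDerivAt_sqrt hv0).sub_const _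
  · exact (integrableOn_thetaRemainder ha n).mono_set fun v hv ↦ hpos.trans_le hv.1
  · intro v hv
    have hv0 : 0 < v := hpos.trans hv.1
    have hE := exp_pos (-v)
    obtain ⟨s, hs, rfl⟩ : ∃ s : ℝ, 0 < s ∧ s ^ 2 = v := ⟨√v, by positivity, sq_sqrt hv0.le⟩
    obtain ⟨r, hr, rfl⟩ : ∃ r : ℝ, 0 < r ∧ r ^ 2 = a := ⟨√a, by positivity, sq_sqrt ha.le⟩
    simp only [thetaRemainder, sqrt_sq hs.le, sqrt_sq hr.le]
    have hlog : 1 - n * r / s ≤ log (s / r) - log n := by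
      have := one_sub_inv_le_log_of_pos (x := s / r / n) (by positivity)
      rw [log_div (by positivity) (by positivity)] at this
      refine le_trans (le_of_eq ?_) this
      field_simp
    have hlog2 : log (s ^ 2 / r ^ 2) = 2 * log (s / r) := by rw [← div_pow, log_pow]; norm_num
    have hH := harmonic_le_log_add_eulerMascheroniConstant hn
    have hQ := quadratic_majorant_nonneg hn r s
    have hmain : (2 - 1 / (2 * n)) * 1 - 4 * n * r * (1 / (2 * s)) ≤
        1 / 2 * log (s ^ 2 / r ^ 2) + eulerMascheroniConstant + 1 - harmonic n
          - n * (r * s⁻¹) := by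
      rw [hlog2]
      have e1 : 4 * n * r * (1 / (2 * s)) = 2 * (n * r / s) := by field_simp; norm_num
      have e2 : n * (r * s⁻¹) = n * r / s := by rw [div_eq_mul_inv]; ring
      rw [e1, e2]
      linarith
    nlinarith [mul_le_mul_of_nonneg_right hmain hE.le, mul_nonneg hQ hE.le]

lemma le_integral_Ioi_thetaRemainder (ha : 0 < a) {n : ℕ} (hn : 1 ≤ n) :
    -(a / 6 * exp (-(n ^ 2 * a))) ≤ ∫ v in Ioi (n ^ 2 * a), thetaRemainder a n v := by
  have hint : IntegrableOn (thetaRemainder a n) (Ioi (n ^ 2 * a)) :=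
    (integrableOn_thetaRemainder ha n).mono_set (Ioi_subset_Ioi (by positivity))
  refine ge_of_tendsto (intervalIntegral_tendsto_integral_Ioi _ hint tendsto_id) ?_
  filter_upwards [eventually_ge_atTop (n ^ 2 * a)] with b hb
  refine le_trans ?_ (le_integral_thetaRemainder ha hn hb)
  have hb0 : 0 ≤ b := le_trans (by positivity) hb
  have h := quadratic_majorant_nonneg hn (√a) (√b)
  rw [sq_sqrt ha.le, sq_sqrt hb0] at h
  have := mul_nonneg h (exp_pos (-b)).le
  simp only [id]
  linarith

lemma le_integral_thetaRemainder_succ (ha : 0 < a) {n : ℕ} (hn : 1 ≤ n) :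
    a / 6 * exp (-((n + 1 : ℕ) ^ 2 * a)) - a / 6 * exp (-(n ^ 2 * a)) ≤
      ∫ v in n ^ 2 * a..(n + 1 : ℕ) ^ 2 * a, thetaRemainder a n v := by
  have hn' : (1 : ℝ) ≤ n := by exact_mod_cast hn
  refine le_trans ?_ (le_integral_thetaRemainder ha hn (by push_cast; gcongr; linarith))
  gcongr
  rw [sqrt_mul (by positivity), sqrt_sq (by positivity)]
  have h1 : (1 : ℝ) / (2 * n) ≤ 1 / 2 := by
    rw [div_le_div_iff₀ (by positivity) (by positivity)]; linarith
  have h2 : (1 : ℝ) / (2 * n) * n = 1 / 2 := by field_simp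
  have h3 : √a * √a = a := mul_self_sqrt ha.le
  have : (2 - 1 / (2 * (n : ℝ))) * ((n + 1 : ℕ) ^ 2 * a - n ^ 2 * a)
      - 4 * n * √a * ((n + 1 : ℕ) * √a - n * √a) + a / 6 =
      (4 * n + 2 - 2 * (1 / (2 * n) * n) - 1 / (2 * n)) * a - 4 * n * (√a * √a) + a / 6 := by
    push_cast; ring
  rw [this, h2, h3]
  nlinarith

lemma le_integral_thetaRemainder_zero (ha : 0 < a) (ha' : a ≤ 5 / 3) :
    a / 6 * exp (-a) ≤ ∫ v in 0..a, thetaRemainder a 0 v := by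
  have hγ := one_half_lt_eulerMascheroniConstant
  have key := intervalIntegral.sub_le_integral_of_hasDeriv_right_of_le
    (g := fun v ↦ 1 / 2 * (v * log v - v - log a * v) - 3 / 2 * exp (-v))
    (g' := fun v ↦ 1 / 2 * (log v + 1 - 1 - log a * 1) - 3 / 2 * (exp (-v) * (-1)))
    (φ := thetaRemainder a 0) ha.le ?_ ?_ ?_ ?_
  · refine le_trans ?_ key
    have h1 : a ≤ (1 - exp (-a)) * (1 + a) := by
      have : exp (-a) * (1 + a) ≤ 1 := by
        rw [exp_neg, inv_mul_le_iff₀ (exp_pos a)]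
        linarith [add_one_le_exp a]
      linarith
    have h2 : 0 ≤ ((1 - exp (-a)) * (3 / 2 + a / 6) - 2 * a / 3) * (1 + a) := by
      nlinarith [mul_le_mul_of_nonneg_right h1 (by positivity : 0 ≤ 3 / 2 + a / 6)]
    have h3 := nonneg_of_mul_nonneg_left h2 (by positivity)
    simp only [neg_zero, exp_zero]
    linarith
  · have := continuous_mul_log
    fun_prop
  · intro v hv
    exact HasDerivAt.hasDerivWithinAt (.sub (.const_mul _ (.sub (.sub (hasDerivAt_mul_log hv.1.ne')
      (hasDerivAt_id v)) (.const_mul _ (hasDerivAt_id v)))) (.const_mul _ (hasDerivAt_neg v).exp))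
  · have := (integrableOn_thetaRemainder ha 0).mono_set (fun v (hv : v ∈ Ioc 0 a) ↦ hv.1)
    rwa [integrableOn_Icc_iff_integrableOn_Ioc]
  · intro v hv
    have hE := exp_pos (-v)
    have hE1 : exp (-v) ≤ 1 := exp_le_one_iff.2 (by linarith [hv.1])
    have hlog := log_le_log hv.1 hv.2.le
    simp only [thetaRemainder, harmonic_zero, Rat.cast_zero, Nat.cast_zero]
    rw [log_div hv.1.ne' ha.ne']
    nlinarith

theorem sum_integral_thetaMajorant_le (ha : 0 < a) (ha' : a ≤ 5 / 3) (M : ℕ) :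
    ∑ n ∈ Finset.range M, ∫ v in Ioi ((n + 1 : ℕ) ^ 2 * a), thetaMajorant a (n + 1) v ≤
      1 + eulerMascheroniConstant / 2 - log a / 2 := by
  have hsplit (n : ℕ) : ∫ v in Ioi (n ^ 2 * a), thetaRemainder a n v =
      (∫ v in n ^ 2 * a..(n + 1 : ℕ) ^ 2 * a, thetaRemainder a n v) +
      (∫ v in Ioi ((n + 1 : ℕ) ^ 2 * a), thetaRemainder a (n + 1) v) +
      ∫ v in Ioi ((n + 1 : ℕ) ^ 2 * a), thetaMajorant a (n + 1) v := by
    have hsub (m : ℕ) : Ioi (m ^ 2 * a) ⊆ Ioi 0 := Ioi_subset_Ioi (by positivity)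
    rw [add_assoc, ← integral_add ((integrableOn_thetaRemainder ha _).mono_set (hsub _))
      ((integrableOn_thetaMajorant _).mono_set (hsub _))]
    simp_rw [thetaRemainder_sub_thetaMajorant]
    exact (intervalIntegral.integral_interval_add_Ioi
      ((integrableOn_thetaRemainder ha _).mono_set (hsub _))
      ((integrableOn_thetaRemainder ha _).mono_set (hsub _))).symm
  have hsum (n : ℕ) : ∑ k ∈ Finset.range (n + 1),
      ∫ v in Ioi ((k + 1 : ℕ) ^ 2 * a), thetaMajorant a (k + 1) v ≤
      1 + eulerMascheroniConstant / 2 - log a / 2 - a / 6 * exp (-((n + 1 : ℕ) ^ 2 * a))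
        - ∫ v in Ioi ((n + 1 : ℕ) ^ 2 * a), thetaRemainder a (n + 1) v := by
    induction n with
    | zero =>
      have h0 := hsplit 0
      have h1 := integral_thetaRemainder_zero ha
      have h2 := le_integral_thetaRemainder_zero ha ha'
      simp only [Nat.cast_zero, zero_add, Nat.cast_one, one_pow, one_mul, ne_eq,
        OfNat.ofNat_ne_zero, not_false_eq_true, zero_pow, zero_mul, Finset.range_one,
        Finset.sum_singleton] at h0 ⊢
      linarith
    | succ n ih =>
      rw [Finset.sum_range_succ]
      linarith [hsplit (n + 1), le_integral_thetaRemainder_succ ha (Nat.le_add_left 1 n)]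
  have hM := hsum M
  rw [Finset.sum_range_succ] at hM
  have hnonneg : 0 ≤ ∫ v in Ioi ((M + 1 : ℕ) ^ 2 * a), thetaMajorant a (M + 1) v :=
    setIntegral_nonneg measurableSet_Ioi fun v _ ↦ by unfold thetaMajorant; positivity
  linarith [le_integral_Ioi_thetaRemainder ha (Nat.le_add_left 1 M)]

end ThetaMajorant

namespace DirichletCharacter

open ZMod HurwitzZeta

lemma norm_gaussSum_stdAddChar {N : ℕ} [NeZero N] {χ : DirichletCharacter ℂ N}
    (hχ : χ.IsPrimitive) : ‖gaussSum χ (stdAddChar (N := N))‖ = √N := by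
  have h : star (gaussSum χ (stdAddChar (N := N))) * gaussSum χ (stdAddChar (N := N)) = N := by
    have h1 := congr_fun (dft_dft (χ : ZMod N → ℂ)) (-1)
    rw [dft_apply] at h1
    simp only [hχ.fourierTransform_eq_inv_mul_gaussSum, neg_neg, map_one, smul_eq_mul, mul_one,
      mul_neg] at h1
    rw [star_gaussSum_eq, gaussSum, Finset.sum_mul, ← h1, ← Equiv.sum_comp (Equiv.neg (ZMod N))]
    refine Finset.sum_congr rfl fun j _ ↦ ?_
    simp only [Equiv.neg_apply, AddChar.inv_apply, neg_neg]
    ring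
  have h2 := congr_arg norm h
  rw [norm_mul, norm_star, Complex.norm_natCast] at h2
  rw [← h2, sqrt_mul_self (norm_nonneg _)]

end DirichletCharacter

lemma ENNReal.tsum_int_of_even {G : ℤ → ENNReal} (h0 : G 0 = 0) (hG : ∀ n, G (-n) = G n) :
    ∑' n, G n = ∑' n : ℕ, 2 * G (n + 1 : ℕ) := by
  have h1 : HasSum (fun n : ℕ ↦ G n) (∑' n : ℕ, G n) := ENNReal.summable.hasSum
  have h2 : HasSum (fun n : ℕ ↦ G (-(n + 1))) (∑' n : ℕ, G (-(n + 1))) := ENNReal.summable.hasSum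
  rw [(h1.of_nat_of_neg_add_one h2).tsum_eq, tsum_eq_zero_add' ENNReal.summable, Nat.cast_zero, h0,
    zero_add, ENNReal.tsum_mul_left, two_mul]
  congr 2
  ext n
  rw [hG]
  push_cast
  rfl

lemma ENNReal.sum_zmod_tsum_int (N : ℕ) [NeZero N] (G : ℤ → ENNReal) :
    ∑ j : ZMod N, ∑' n : ℤ, G (n * N + j.val) = ∑' n, G n := by
  obtain ⟨k, rfl⟩ := Nat.exists_eq_succ_of_ne_zero (NeZero.ne N)
  rw [← (Int.divModEquiv (k + 1)).symm.tsum_eq,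
    ENNReal.tsum_prod (f := fun n j ↦ G ((Int.divModEquiv (k + 1)).symm (n, j))),
    ENNReal.tsum_comm, tsum_fintype]
  rfl

lemma HasSum.enorm_le_tsum {ι E : Type*} [NormedAddCommGroup E] {f : ι → E} {s : E}
    (h : HasSum f s) : ‖s‖ₑ ≤ ∑' i, ‖f i‖ₑ := by
  refine le_of_tendsto h.enorm (Eventually.of_forall fun t ↦ ?_)
  exact (enorm_sum_le _ _).trans (ENNReal.sum_le_tsum t)

namespace DirichletCharacter

open ZMod HurwitzZeta

variable {N : ℕ} [NeZero N] (χ : DirichletCharacter ℂ N)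

lemma enorm_sum_mul_oddKernel_le {x : ℝ} (hx : 0 < x) :
    ‖∑ j, χ j * (oddKernel (toAddCircle j) x : ℂ)‖ₑ ≤
      ∑' n : ℕ, ENNReal.ofReal (2 * ((n + 1 : ℕ) / N) * exp (-π * ((n + 1 : ℕ) / N) ^ 2 * x)) := by
  set G : ℤ → ENNReal := fun m ↦ ENNReal.ofReal (|(m : ℝ) / N| * exp (-π * (m / N) ^ 2 * x)) with hG
  have hN : (N : ℝ) ≠ 0 := NeZero.ne _
  calc ‖∑ j, χ j * (oddKernel (toAddCircle j) x : ℂ)‖ₑ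
    _ ≤ ∑ j, ‖χ j * (oddKernel (toAddCircle j) x : ℂ)‖ₑ := enorm_sum_le _ _
    _ ≤ ∑ j : ZMod N, ∑' n : ℤ, G (n * N + j.val) := by
      refine Finset.sum_le_sum fun j _ ↦ ?_
      have h1 : ‖χ j‖ₑ ≤ 1 := by
        rw [← ofReal_norm, ENNReal.ofReal_le_one]
        exact χ.norm_le_one j
      rw [enorm_mul]
      refine (mul_le_of_le_one_left' h1).trans ?_
      rw [toAddCircle_apply, enorm_eq_nnnorm, Complex.nnnorm_real, ← enorm_eq_nnnorm]
      refine (hasSum_int_oddKernel _ hx).enorm_le_tsum.trans_eq (tsum_congr fun n ↦ ?_)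
      have : (((n * N + j.val : ℤ) : ℝ) / N) = n + j.val / N := by
        push_cast; field_simp
      simp only [hG, this]
      rw [← ofReal_norm, norm_mul, norm_eq_abs, norm_of_nonneg (exp_pos _).le]
    _ = ∑' n, G n := ENNReal.sum_zmod_tsum_int N G
    _ = _ := by
      rw [ENNReal.tsum_int_of_even (by simp [hG]) (fun n ↦ by simp [hG, neg_div])]
      refine tsum_congr fun n ↦ ?_
      rw [hG, ← ENNReal.ofReal_ofNat, ← ENNReal.ofReal_mul (by norm_num), ← mul_assoc,
        Int.cast_natCast, abs_of_nonneg (by positivity)]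

variable {χ}

lemma enorm_sum_mul_sinKernel_le (hχ : χ.IsPrimitive) {t : ℝ} (ht : 0 < t) :
    ‖∑ j, χ j * (sinKernel (toAddCircle j) t : ℂ)‖ₑ ≤
      ∑' n : ℕ, ENNReal.ofReal (2 * √N * (n + 1 : ℕ) * exp (-π * (n + 1 : ℕ) ^ 2 * t)) := by
  set G : ℤ → ENNReal := fun m ↦ ENNReal.ofReal (√N * |(m : ℝ)| * exp (-π * m ^ 2 * t)) with hG
  have hsum : HasSum (fun n : ℤ ↦ -Complex.I * n * (χ⁻¹ n * gaussSum χ stdAddChar) *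
      exp (-π * n ^ 2 * t)) (∑ j, χ j * (sinKernel (toAddCircle j) t : ℂ)) := by
    have h := hasSum_sum (s := Finset.univ) fun (j : ZMod N) _ ↦
      (hasSum_int_sinKernel (j.val / N : ℝ) ht).mul_left (χ j)
    simp_rw [toAddCircle_apply]
    refine h.congr_fun fun n ↦ ?_
    rw [← gaussSum_mulShift_of_isPrimitive _ hχ, gaussSum, Finset.mul_sum, Finset.sum_mul]
    refine Finset.sum_congr rfl fun j _ ↦ ?_
    have : stdAddChar.mulShift (n : ZMod N) j =
        Complex.exp (2 * π * Complex.I * (j.val / N : ℝ) * n) := by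
      rw [AddChar.mulShift_apply]
      have := stdAddChar_coe (N := N) (n * j.val)
      push_cast [natCast_zmod_val] at this ⊢
      rw [this]
      congr 1
      ring
    rw [this]
    ring
  calc ‖∑ j, χ j * (sinKernel (toAddCircle j) t : ℂ)‖ₑ
    _ ≤ ∑' n, G n := by
      refine hsum.enorm_le_tsum.trans (ENNReal.tsum_le_tsum fun n ↦ ?_)
      rw [← ofReal_norm]
      refine ENNReal.ofReal_le_ofReal ?_
      rw [norm_mul, norm_mul, norm_mul, norm_mul, norm_neg, Complex.norm_I, Complex.norm_intCast,
        norm_gaussSum_stdAddChar hχ, Complex.norm_real, norm_of_nonneg (exp_pos _).le, one_mul]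
      rw [mul_comm (√N)]
      gcongr
      exact mul_le_of_le_one_left (by positivity) (χ⁻¹.norm_le_one n)
    _ = _ := by
      rw [ENNReal.tsum_int_of_even (by simp [hG]) (fun n ↦ by simp [hG])]
      refine tsum_congr fun n ↦ ?_
      rw [hG, ← ENNReal.ofReal_ofNat, ← ENNReal.ofReal_mul (by norm_num),
        Int.cast_natCast, abs_of_nonneg (by positivity)]
      congr 1
      ring

lemma enorm_LFunction_one_le_of_odd (hodd : χ.Odd) :
    ‖χ.LFunction 1‖ₑ ≤ ENNReal.ofReal (π / (2 * N)) *
      ∫⁻ x in Ioi 0, ‖∑ j, χ j * (oddKernel (toAddCircle j) x : ℂ)‖ₑ := by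
  have hmellin (b : UnitAddCircle) :
      IntegrableOn (fun x ↦ (oddKernel b x : ℂ)) (Ioi 0) ∧
      hurwitzZetaOdd b 1 = π / 2 * ∫ x in Ioi (0 : ℝ), (oddKernel b x : ℂ) := by
    have h := (isStrong_hurwitzOddFEPair b).hasMellin 1
    simp only [HasMellin, MellinConvergent, mellin, sub_self, Complex.cpow_zero, one_smul] at h
    refine ⟨h.1, ?_⟩
    rw [hurwitzZetaOdd, completedHurwitzZetaOdd]
    have e : ((1 : ℂ) + 1) / 2 = 1 := by norm_num
    have e2 : Complex.Gammaℝ (1 + 1) = 1 / π := by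
      rw [Complex.Gammaℝ_def, e, Complex.Gamma_one, neg_div, e, Complex.cpow_neg_one]; simp
    rw [e, e2, ← h.2]
    simp only [hurwitzOddFEPair, Function.comp_apply]
    field_simp
  have h1 : χ.LFunction 1 = (π / (2 * N) : ℝ) *
      ∫ x in Ioi (0 : ℝ), ∑ j, χ j * (oddKernel (toAddCircle j) x : ℂ) := by
    rw [integral_finsetSum _ fun j _ ↦ (hmellin _).1.const_mul _, LFunction,
      LFunction_def_odd hodd.to_fun, Complex.cpow_neg_one, Finset.mul_sum, Finset.mul_sum]
    refine Finset.sum_congr rfl fun j _ ↦ ?_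
    rw [(hmellin _).2, integral_const_mul]
    push_cast
    field_simp
  rw [h1, enorm_mul]
  gcongr
  · rw [← ofReal_norm, Complex.norm_real, norm_of_nonneg (by positivity)]
  · exact enorm_integral_le_lintegral_enorm _

end DirichletCharacter

lemma lintegral_Ioi_exp_theta {N m : ℝ} (hN : 0 < N) (hm : 0 < m) :
    ENNReal.ofReal (π / (2 * N)) *
      ∫⁻ x in Ioi N, ENNReal.ofReal (2 * (m / N) * exp (-π * (m / N) ^ 2 * x)) =
    ∫⁻ v in Ioi (m ^ 2 * (π / N)), ENNReal.ofReal (m⁻¹ * exp (-v)) := by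
  have himage : (fun x ↦ π * (m / N) ^ 2 * x) '' Ioi N = Ioi (m ^ 2 * (π / N)) := by
    rw [image_mul_left_Ioi (by positivity)]
    congr 1
    field_simp
  rw [← himage, lintegral_image_eq_lintegral_abs_deriv_mul measurableSet_Ioi
    (fun x _ ↦ ((hasDerivAt_id' x).const_mul (π * (m / N) ^ 2)).hasDerivWithinAt)
    (mul_right_injective₀ (by positivity)).injOn, ← lintegral_const_mul _ (by fun_prop)]
  refine lintegral_congr fun x ↦ ?_
  rw [← ENNReal.ofReal_mul (by positivity), ← ENNReal.ofReal_mul (by positivity),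
    abs_of_nonneg (by positivity)]
  congr 1
  rw [show -π * (m / N) ^ 2 * x = -(π * (m / N) ^ 2 * x) by ring]
  field_simp

lemma lintegral_Ioo_exp_theta {N m : ℝ} (hN : 0 < N) (hm : 0 < m) :
    ENNReal.ofReal (π / (2 * N)) * ∫⁻ x in Ioo 0 N, ENNReal.ofReal
      (1 / x ^ (3 / 2 : ℝ) * (2 * √N * m * exp (-π * m ^ 2 * (1 / x)))) =
    ∫⁻ v in Ioi (m ^ 2 * (π / N)), ENNReal.ofReal (√(π / N) * (√v)⁻¹ * exp (-v)) := by
  have himage : (fun x ↦ π * m ^ 2 * x⁻¹) '' Ioo 0 N = Ioi (m ^ 2 * (π / N)) := by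
    rw [← image_image (fun x ↦ π * m ^ 2 * x) (fun x ↦ x⁻¹), image_inv_eq_inv,
      inv_Ioo_0_left hN, image_mul_left_Ioi (by positivity)]
    congr 1
    field_simp
  rw [← himage, lintegral_image_eq_lintegral_abs_deriv_mul measurableSet_Ioo
    (fun x hx ↦ ((hasDerivAt_inv hx.1.ne').const_mul (π * m ^ 2)).hasDerivWithinAt)
    ((mul_right_injective₀ (by positivity)).comp inv_injective).injOn,
    ← lintegral_const_mul _ (by fun_prop)]
  refine setLIntegral_congr_fun measurableSet_Ioo fun x hx ↦ ?_
  have hx0 := hx.1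
  rw [← ENNReal.ofReal_mul (by positivity), ← ENNReal.ofReal_mul (by positivity),
    mul_neg, abs_neg, abs_of_nonneg (by positivity)]
  congr 1
  rw [show -π * m ^ 2 * (1 / x) = -(π * m ^ 2 * x⁻¹) by ring]
  have h32 : x ^ (3 / 2 : ℝ) = x * √x := by
    rw [show (3 / 2 : ℝ) = 1 + 1 / 2 by norm_num, rpow_add hx0, rpow_one, sqrt_eq_rpow]
  rw [h32, sqrt_div pi_pos.le, sqrt_mul (by positivity), sqrt_mul pi_pos.le, sqrt_sq hm.le,
    sqrt_inv]
  have h3 : 0 < √x := by positivity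
  have h4 : 0 < √N := by positivity
  have h5 : 0 < √π := by positivity
  field_simp
  rw [sq_sqrt hN.le, sq_sqrt hx0.le, mul_comm]

namespace DirichletCharacter

open ZMod HurwitzZeta

variable {N : ℕ} [NeZero N] {χ : DirichletCharacter ℂ N}

lemma enorm_LFunction_one_le_tsum (hχ : χ.IsPrimitive) (hodd : χ.Odd) :
    ‖χ.LFunction 1‖ₑ ≤ ∑' n : ℕ, ∫⁻ v in Ioi ((n + 1 : ℕ) ^ 2 * (π / N)),
      ENNReal.ofReal (thetaMajorant (π / N) (n + 1) v) := by
  have hN : (0 : ℝ) < N := Nat.cast_pos.2 (NeZero.pos N)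
  refine (enorm_LFunction_one_le_of_odd hodd).trans ?_
  have hset : Ioi (0 : ℝ) = Ioo 0 (N : ℝ) ∪ Ici (N : ℝ) := (Ioo_union_Ici_eq_Ioi hN).symm
  rw [hset, lintegral_union measurableSet_Ici (by
    rw [Set.disjoint_left]; exact fun x hx hx' ↦ hx.2.not_ge hx'), mul_add,
    setLIntegral_congr Ioi_ae_eq_Ici.symm]
  have hlow : ENNReal.ofReal (π / (2 * N)) *
      ∫⁻ x in Ioo 0 (N : ℝ), ‖∑ j, χ j * (oddKernel (toAddCircle j) x : ℂ)‖ₑ ≤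
      ∑' n : ℕ, ∫⁻ v in Ioi ((n + 1 : ℕ) ^ 2 * (π / N)),
        ENNReal.ofReal (√(π / N) * (√v)⁻¹ * exp (-v)) := by
    simp_rw [← lintegral_Ioo_exp_theta hN (Nat.cast_pos.2 (Nat.succ_pos _))]
    rw [ENNReal.tsum_mul_left, ← lintegral_tsum fun n ↦ by fun_prop]
    refine mul_le_mul' le_rfl (setLIntegral_mono' measurableSet_Ioo fun x hx ↦ ?_)
    have hx0 := hx.1
    have hker (b : UnitAddCircle) : (oddKernel b x : ℂ) =
        ((1 / x ^ (3 / 2 : ℝ) : ℝ) : ℂ) * (sinKernel b (1 / x) : ℂ) := by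
      rw [oddKernel_functional_equation]; push_cast; rfl
    simp_rw [hker, mul_left_comm (χ _), ← Finset.mul_sum,
      ENNReal.ofReal_mul (p := 1 / x ^ (3 / 2 : ℝ)) (by positivity), ENNReal.tsum_mul_left]
    rw [enorm_mul, ← ofReal_norm, Complex.norm_real, norm_of_nonneg (by positivity)]
    gcongr
    exact enorm_sum_mul_sinKernel_le hχ (by positivity)
  have hhigh : ENNReal.ofReal (π / (2 * N)) *
      ∫⁻ x in Ioi (N : ℝ), ‖∑ j, χ j * (oddKernel (toAddCircle j) x : ℂ)‖ₑ ≤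
      ∑' n : ℕ, ∫⁻ v in Ioi ((n + 1 : ℕ) ^ 2 * (π / N)),
        ENNReal.ofReal (((n + 1 : ℕ) : ℝ)⁻¹ * exp (-v)) := by
    simp_rw [← lintegral_Ioi_exp_theta hN (Nat.cast_pos.2 (Nat.succ_pos _))]
    rw [ENNReal.tsum_mul_left, ← lintegral_tsum fun n ↦ by fun_prop]
    exact mul_le_mul' le_rfl (setLIntegral_mono' measurableSet_Ioi fun x hx ↦
      enorm_sum_mul_oddKernel_le χ (hN.trans hx))
  refine (add_le_add hlow hhigh).trans_eq ?_
  rw [← ENNReal.tsum_add]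
  refine tsum_congr fun n ↦ ?_
  rw [← lintegral_add_left (by fun_prop)]
  refine lintegral_congr fun v ↦ ?_
  rw [← ENNReal.ofReal_add (by positivity) (by positivity), thetaMajorant]
  congr 1
  ring

end DirichletCharacter

/-- Louboutin's bound for odd primitive Dirichlet characters: if `χ` is a primitive
odd Dirichlet character of conductor `f > 1`, then
`|L(1,χ)| ≤ (1/2)·log f + (2 + γ - log π)/2`. -/
theorem stmt_7 (f : ℕ) [NeZero f] (hf : 1 < f) (χ : DirichletCharacter ℂ f)
    (hχ : χ.IsPrimitive) (hodd : χ.Odd) :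
    ‖χ.LFunction 1‖ ≤
      (1 / 2) * Real.log f + (2 + eulerMascheroniConstant - Real.log π) / 2 := by
  have hf' : (2 : ℝ) ≤ f := by exact_mod_cast hf
  have ha : 0 < π / f := by positivity
  have ha' : π / f ≤ 5 / 3 := by
    rw [div_le_iff₀ (by positivity)]
    linarith [pi_lt_d2]
  have hbound := sum_integral_thetaMajorant_le ha ha'
  have hnonneg : 0 ≤ 1 + eulerMascheroniConstant / 2 - log (π / f) / 2 := by simpa using hbound 0
  have hnn (n : ℕ) (v : ℝ) : 0 ≤ thetaMajorant (π / f) n v := by unfold thetaMajorant; positivity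
  have key : ‖χ.LFunction 1‖ ≤ 1 + eulerMascheroniConstant / 2 - log (π / f) / 2 := by
    rw [← ENNReal.ofReal_le_ofReal_iff hnonneg, ofReal_norm]
    refine (DirichletCharacter.enorm_LFunction_one_le_tsum hχ hodd).trans
      (ENNReal.tsum_le_of_sum_range_le fun M ↦ ?_)
    refine le_trans (le_of_eq ?_) (ENNReal.ofReal_le_ofReal (hbound M))
    rw [ENNReal.ofReal_sum_of_nonneg fun n _ ↦ integral_nonneg fun v ↦ hnn _ v]
    refine Finset.sum_congr rfl fun n _ ↦ ?_
    exact (ofReal_integral_eq_lintegral_ofReal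
      ((integrableOn_thetaMajorant _).mono_set (Ioi_subset_Ioi (by positivity)))
      (Eventually.of_forall fun v ↦ hnn _ v)).symm
  refine key.trans_eq ?_
  rw [log_div pi_ne_zero (by positivity)]
  ring
end
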